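/- For every integer n ≥ 2 and all indices with 1 ≤ l ≤ j ≤ i ≤ n−1, the equation h^{[i,j]} h^{[j,l]} = c h^{[i,l]} holds in the Kauffman monoid K_n. -/

import Mathlib

/-!
Kauffman monoid `K n` for `n ≥ 2`: presented by generators `h^1, …, h^{n-1}`
(diapsides) and `c` (circle), subject to
`h^i h^j = h^j h^i` for `|i-j| ≥ 2`, `h^i h^{i±1} h^i = h^i`,
`h^i c = c h^i`, `h^i h^i = c h^i`.
-/

namespace Kauffman

/-- Valid diapsis indices `1 ≤ i ≤ n-1`. -/
def Idx (n : ℕ) : Type := {i : ℕ // 1 ≤ i ∧ i ≤ n - 1}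

/-- Generators of the Kauffman monoid. -/
inductive Gen (n : ℕ) : Type
  | h : Idx n → Gen n
  | c : Gen n

/-- The defining relations of the Kauffman monoid. -/
inductive Rel (n : ℕ) : FreeMonoid (Gen n) → FreeMonoid (Gen n) → Prop
  | comm (i j : Idx n) (hij : i.1 + 2 ≤ j.1 ∨ j.1 + 2 ≤ i.1) :
      Rel n (FreeMonoid.of (Gen.h i) * FreeMonoid.of (Gen.h j))
            (FreeMonoid.of (Gen.h j) * FreeMonoid.of (Gen.h i))
  | absorb (i j : Idx n) (hij : j.1 = i.1 + 1 ∨ i.1 = j.1 + 1) :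
      Rel n (FreeMonoid.of (Gen.h i) * FreeMonoid.of (Gen.h j) * FreeMonoid.of (Gen.h i))
            (FreeMonoid.of (Gen.h i))
  | hc (i : Idx n) :
      Rel n (FreeMonoid.of (Gen.h i) * FreeMonoid.of Gen.c)
            (FreeMonoid.of Gen.c * FreeMonoid.of (Gen.h i))
  | hh (i : Idx n) :
      Rel n (FreeMonoid.of (Gen.h i) * FreeMonoid.of (Gen.h i))
            (FreeMonoid.of Gen.c * FreeMonoid.of (Gen.h i))

/-- The congruence generated by the Kauffman relations. -/
def kcon (n : ℕ) : Con (FreeMonoid (Gen n)) := conGen (Rel n)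

/-- The Kauffman monoid `K n`. -/
abbrev K (n : ℕ) : Type := (kcon n).Quotient

/-- The diapsis `h^i` as an element of `K n` (defined to be `1` for out-of-range `i`). -/
def hK (n i : ℕ) : K n :=
  if h : 1 ≤ i ∧ i ≤ n - 1 then ((FreeMonoid.of (Gen.h ⟨i, h⟩) : FreeMonoid (Gen n)) : K n)
  else 1

/-- The circle `c` as an element of `K n`. -/
def cK (n : ℕ) : K n := ((FreeMonoid.of Gen.c : FreeMonoid (Gen n)) : K n)

/-- The block `h^{[i,j]} = h^i h^{i-1} ⋯ h^{j+1} h^j` (for `j ≤ i`). -/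
def block (n i j : ℕ) : K n :=
  (((List.range (i + 1 - j)).map fun t => hK n (i - t))).prod

end Kauffman

namespace Kauffman

/-- Diapsides commute with the circle. -/
theorem hK_mul_cK (n i : ℕ) : hK n i * cK n = cK n * hK n i := by
  unfold hK
  split_ifs with h
  · exact (Con.eq _).2 (ConGen.Rel.of _ _ (Rel.hc ⟨i, h⟩))
  · rw [one_mul, mul_one]

/-- Squaring a diapsis produces a circle. -/
theorem hK_mul_self {n i : ℕ} (h : 1 ≤ i ∧ i ≤ n - 1) :
    hK n i * hK n i = cK n * hK n i := by
  rw [hK, dif_pos h]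
  exact (Con.eq _).2 (ConGen.Rel.of _ _ (Rel.hh ⟨i, h⟩))

theorem block_self (n i : ℕ) : block n i i = hK n i := by
  simp [block]

/-- A block one row longer is obtained by multiplying by the new top diapsis on the left. -/
theorem block_succ {n i j : ℕ} (hji : j ≤ i) :
    block n (i + 1) j = hK n (i + 1) * block n i j := by
  have hlen : i + 1 + 1 - j = (i + 1 - j) + 1 := by omega
  rw [block, hlen, List.range_succ_eq_map, List.map_cons, List.prod_cons, List.map_map,
    Nat.sub_zero, block]
  congr 3
  funext t
  exact congrArg (hK n) (by omega)

/-- Multiplying a block on the left by its top diapsis produces a circle. -/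
theorem hK_mul_block {n j l : ℕ} (hl : 1 ≤ l) (hlj : l ≤ j) (hj : j ≤ n - 1) :
    hK n j * block n j l = cK n * block n j l := by
  obtain rfl | hlt := hlj.eq_or_lt
  · rw [block_self, hK_mul_self ⟨hl, hj⟩]
  · obtain ⟨k, rfl⟩ := Nat.exists_eq_add_one_of_ne_zero (by omega : j ≠ 0)
    rw [block_succ (by omega), ← mul_assoc, hK_mul_self ⟨by omega, hj⟩, mul_assoc]

end Kauffman

open Kauffman in
/-- `(hc II)`: for `1 ≤ l ≤ j ≤ i ≤ n-1`,
`h^{[i,j]} h^{[j,l]} = c h^{[i,l]}` in `K n`. -/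
theorem kauffman_block_circle (n i j l : ℕ) (hn : 2 ≤ n)
    (hl : 1 ≤ l) (hlj : l ≤ j) (hji : j ≤ i) (hi : i ≤ n - 1) :
    block n i j * block n j l = cK n * block n i l := by
  induction i, hji using Nat.le_induction with
  | base => rw [block_self, hK_mul_block hl hlj hi]
  | succ i hji ih =>
    rw [block_succ hji, block_succ (hlj.trans hji), mul_assoc, ih (by omega), ← mul_assoc,
      hK_mul_cK, mul_assoc]
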